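/- For every L > 0 and every k₄ ≥ 0 there exist gains k₁, k₂, k₃ > 0 (depending on L and k₄) such that the following holds: for every ρ : ℝ → ℝ that is Lipschitz with constant L, and for every Filippov solution (x₁, x₂, z) on [0,∞) of the closed-loop system ẋ₁ = x₂, ẋ₂ = −k₁⌈x₁⌋^{1/3} − k₂⌈x₂⌋^{1/2} + z + ρ(t), ż = −k₃⌈x₁ + k₄⌈x₂⌋^{3/2}⌋⁰ — meaning x₁, x₂ are C¹, z is locally Lipschitz, the first two equations hold for all t ≥ 0, and for almost every t ≥ 0 one has ż(t) = −k₃·sign(x₁(t) + k₄⌈x₂(t)⌋^{3/2}) whenever x₁(t) + k₄⌈x₂(t)⌋^{3/2} ≠ 0 and |ż(t)| ≤ k₃ otherwise — there exists a time T ≥ 0 such that x₁(t) = 0, x₂(t) = 0 and z(t) + ρ(t) = 0 for all t ≥ T. -/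

import Mathlib

open MeasureTheory

/-- Signed power: `⌈z⌋^p = |z|^p · sign z` (for `p = 0` this is `sign z`). -/
noncomputable def spow (z p : ℝ) : ℝ := |z| ^ p * Real.sign z


lemma core_ineq (U A M p Q α B ε γ K D : ℝ) (hU : 0 ≤ U) (hA : 0 ≤ A) (hM : 0 ≤ M) (hp : 0 ≤ p)
    (hQ : 0 ≤ Q) (hα : 0 ≤ α) (hαM : α ≤ M) (hε : 0 < ε) (hε1 : ε ≤ 1/12800000)
    (hγ : γ = 40000 * ε) (hK : ε * K ≤ 1/112)
    (h4 : M^4 + A^4 ≤ 4 * U) (hUp : U ≤ 4*M^4 + 2*A^4)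
    (hQ1 : Q ≤ 2*M^3) (hQ2 : Q ≤ 3*M^2*p) (hMQ : M^3 ≤ Q + α^3)
    (hB : B ≤ 3*ε*α^3)
    (hB2 : Q ≤ α^3/2 → B ≤ -ε*α^3 ∨ α^3/2 ≤ K*A^3)
    (hD : D ≤ -2*U*A^3 + 2*γ*A^4*Q - γ*Q^2*p + γ*Q^2*A + 18*γ*ε*A^2*α^2*Q + 6*ε*U*Q + 8*U*B) :
    D ≤ -(ε/2)*M^7 ∧ D ≤ -(ε/2)*A^7 := by
  have hγ0 : 0 < γ := by rw [hγ]; positivity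
  have hγ1 : γ ≤ 1/320 := by rw [hγ]; linarith
  have hM4 : M^4 ≤ 4*U := by have := pow_nonneg hA 4; linarith
  have hA4 : A^4 ≤ 4*U := by have := pow_nonneg hM 4; linarith
  have hA3 : 0 ≤ A^3 := pow_nonneg hA 3
  have hM3 : 0 ≤ M^3 := pow_nonneg hM 3
  have hα3 : 0 ≤ α^3 := pow_nonneg hα 3
  have hUA : 0 ≤ U*A^3 := mul_nonneg hU hA3
  have T1 : 2*γ*A^4*Q ≤ 16*γ*(U*A^3) := by
    have h1 : A*M^3 ≤ A^4 + M^4 := by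
      rcases le_total A M with h | h
      · have : A*M^3 ≤ M*M^3 := by gcongr
        have := pow_nonneg hA 4; nlinarith
      · have : A*M^3 ≤ A*A^3 := by gcongr
        have := pow_nonneg hM 4; nlinarith
    calc 2*γ*A^4*Q ≤ 2*γ*A^4*(2*M^3) := by gcongr
      _ = 4*γ*A^3*(A*M^3) := by ring
      _ ≤ 4*γ*A^3*(4*U) := mul_le_mul_of_nonneg_left (by linarith) (by positivity)
      _ = _ := by ring
  have T2 : γ*Q^2*A ≤ γ*Q^2*p/2 + 144*γ*(U*A^3) := by
    rcases le_total (2*A) p with h | h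
    · have : γ*Q^2*(2*A) ≤ γ*Q^2*p := by gcongr
      have : 0 ≤ γ*(U*A^3) := by positivity
      linarith
    · have h1 : Q ≤ 6*M^2*A := by
        calc Q ≤ 3*M^2*p := hQ2
          _ ≤ 3*M^2*(2*A) := by gcongr
          _ = _ := by ring
      have : γ*Q^2*A ≤ γ*(6*M^2*A)^2*A := by gcongr
      have h3 : γ*(6*M^2*A)^2*A = 36*γ*A^3*M^4 := by ring
      have h4 : 36*γ*A^3*M^4 ≤ 36*γ*A^3*(4*U) := by gcongr
      have : 0 ≤ γ*Q^2*p := by positivity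
      linarith
  have T3 : 18*γ*ε*A^2*α^2*Q ≤ ε*U*Q := by
    have h1 : A^2*α^2 ≤ 2*U := by
      have : α^2 ≤ M^2 := by gcongr
      have : A^2*α^2 ≤ A^2*M^2 := by gcongr
      nlinarith [sq_nonneg (A^2-M^2)]
    calc 18*γ*ε*A^2*α^2*Q = 18*γ*ε*Q*(A^2*α^2) := by ring
      _ ≤ 18*γ*ε*Q*(2*U) := by gcongr
      _ = (36*γ)*(ε*U*Q) := by ring
      _ ≤ 1*(ε*U*Q) := by gcongr; linarith
      _ = _ := by ring
  have hS : γ*(U*A^3) ≤ 1/320*(U*A^3) := by gcongr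
  have hD1 : D ≤ -(3/2)*(U*A^3) - γ*Q^2*p/2 + 7*(ε*U*Q) + 8*(U*B) := by linarith
  have hUA7 : A^7 ≤ 4*(U*A^3) := by
    calc A^7 = A^4*A^3 := by ring
      _ ≤ (4*U)*A^3 := by gcongr
      _ = _ := by ring
  have hM7 : 0 ≤ M^7 := by positivity
  have hA7 : 0 ≤ A^7 := by positivity
  rcases le_or_gt Q (α^3/2) with hc | hc
  · have hUα : M^7 ≤ 6*(U*α^3) := by
      calc M^7 = M^4*M^3 := by ring
        _ ≤ (4*U)*(3/2*α^3) := by gcongr; linarith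
        _ = _ := by ring
    have hg : 0 ≤ γ*Q^2*p := by positivity
    have hUa0 : 0 ≤ U*α^3 := by positivity
    have hεUa0 : 0 ≤ ε*(U*α^3) := by positivity
    have h7 : ε*U*Q ≤ ε*U*(α^3/2) := by gcongr
    have e1 : ε*M^7 ≤ ε*(6*(U*α^3)) := by gcongr
    have e2 : ε*A^7 ≤ ε*(4*(U*A^3)) := by gcongr
    have e3 : ε*(U*A^3) ≤ 1/12800000*(U*A^3) := by gcongr
    rcases hB2 hc with h | h
    · have h8 : U*B ≤ U*(-ε*α^3) := by gcongr
      constructor <;> linarith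
    · have h8 : U*B ≤ U*(3*ε*α^3) := by gcongr
      have h9 : ε*(U*(α^3/2)) ≤ ε*(U*(K*A^3)) := by gcongr
      have h10 : (ε*K)*(U*A^3) ≤ 1/112*(U*A^3) := by gcongr
      have h11 : ε*(U*(K*A^3)) = (ε*K)*(U*A^3) := by ring
      constructor <;> linarith
  · have h8 : U*B ≤ U*(3*ε*(2*Q)) := by
      have : 3*ε*α^3 ≤ 3*ε*(2*Q) := by gcongr; linarith
      gcongr; linarith
    have hD2 : D ≤ -(3/2)*(U*A^3) - γ*Q^2*p/2 + 55*(ε*U*Q) := by linarith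
    have hM3Q : M^3 ≤ 3*Q := by linarith
    have e3 : ε*(U*A^3) ≤ 1/12800000*(U*A^3) := by gcongr
    have e2 : ε*A^7 ≤ ε*(4*(U*A^3)) := by gcongr
    have hg : 0 ≤ γ*Q^2*p := by positivity
    rcases le_total M A with h | h
    · have h9 : ε*U*Q ≤ ε*U*(2*A^3) := by
        have : M^3 ≤ A^3 := by gcongr
        gcongr; linarith
      have : ε*M^7 ≤ ε*A^7 := by gcongr
      constructor <;> linarith
    · have hAM : A^4 ≤ M^4 := by gcongr
      have h9 : ε*U*Q ≤ ε*(6*M^4)*Q := by gcongr; linarith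
      have hMp : M ≤ 9*p := by
        rcases hM.eq_or_lt with h0 | h0
        · rw [← h0]; positivity
        · have : M^2*M ≤ M^2*(9*p) := by linarith
          exact le_of_mul_le_mul_left this (by positivity)
      have h10 : γ*Q*(M^3/3)*(M/9) ≤ γ*Q*Q*p := by gcongr <;> linarith
      have h11 : γ*Q*(M^3/3)*(M/9) = 40000/27*(ε*M^4*Q) := by rw [hγ]; ring
      have h12 : ε*M^4*(M^3/3) ≤ ε*M^4*Q := by gcongr; linarith
      have h13 : ε*A^7 ≤ ε*M^7 := by gcongr
      constructor <;> linarith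

set_option maxHeartbeats 1000000 in
lemma alg_ineq (y v a b ε γ K : ℝ) (hε : 0 < ε) (hε1 : ε ≤ 1/12800000)
    (hγ : γ = 40000 * ε) (hK : ε * K ≤ 1/112) (hK0 : 0 ≤ K)
    (hb : |b| ≤ 3*ε) (hb1 : 0 < (y^3 + K*v^3) * a → b * SignType.sign a ≤ -ε)
    (U q D : ℝ) (hU : U = 3/4*y^4 - a*y^3 + 5/4*a^4 + v^4/2) (hq : q = y^3 - a^3)
    (hD : D = 2*U*(-|v|^3 - q*b + 4*a^3*b) + γ*(2*v^4*|q| - q*|q| *(y-a) - q*|q| *v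
        - 6*(v*|v|)*|q| *a^2*b)) :
    ∀ N, (N = |y| ∨ N = |v| ∨ N = |a|) → D ≤ -(ε/2)*N^7 := by
  have hγ0 : 0 < γ := by rw [hγ]; positivity
  set A := |v| with hA
  set M := max |y| |a| with hM
  have hyM : |y| ≤ M := le_max_left _ _
  have haM : |a| ≤ M := le_max_right _ _
  have hM0 : 0 ≤ M := (abs_nonneg y).trans hyM
  have hA0 : 0 ≤ A := abs_nonneg v
  have hA4 : A^4 = v^4 := by rw [hA, ← abs_pow]; exact abs_of_nonneg (by positivity)
  have hy4 : |y|^4 = y^4 := by rw [← abs_pow]; exact abs_of_nonneg (by positivity)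
  have ha4 : |a|^4 = a^4 := by rw [← abs_pow]; exact abs_of_nonneg (by positivity)
  have hy2 : y^2 ≤ M^2 := by rw [← sq_abs y]; gcongr
  have ha2 : a^2 ≤ M^2 := by rw [← sq_abs a]; gcongr
  have hyM4 : y^4 ≤ M^4 := by rw [← hy4]; gcongr
  have haM4 : a^4 ≤ M^4 := by rw [← ha4]; gcongr
  have hMy : M^4 ≤ y^4 + a^4 := by
    rcases max_choice |y| |a| with h | h
    · rw [hM, h, hy4]; have : 0 ≤ a^4 := by positivity
      linarith
    · rw [hM, h, ha4]; have : 0 ≤ y^4 := by positivity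
      linarith
  have hpoly : 0 ≤ 1/2*y^4 - a*y^3 + a^4 := by
    have h1 : 0 ≤ (a^2 - 2/5*y^2)^2 := sq_nonneg _
    have h2 : 0 ≤ (y^2*4/5)*(a - 5/8*y)^2 := by positivity
    have h3 : 0 ≤ y^4 := by positivity
    linarith
  have hUlow : M^4 + A^4 ≤ 4*U := by
    rw [hU, hA4]; have hv4 : 0 ≤ v^4 := by positivity
    linarith
  have hUup : U ≤ 4*M^4 + 2*A^4 := by
    rw [hU, hA4]
    have : -(a*y^3) ≤ 3/4*y^4 + 1/4*a^4 := by
      have e1 := mul_nonneg (sq_nonneg (y+a)) (sq_nonneg (y - a))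
      have e2 := mul_nonneg (sq_nonneg (y+a)) (sq_nonneg y)
      linarith
    have hv4 : 0 ≤ v^4 := by positivity
    linarith
  have hU0 : 0 ≤ U := by have := pow_nonneg hM0 4; have := pow_nonneg hA0 4; linarith
  have hq1 : |q| ≤ 2*M^3 := by
    rw [hq]
    calc |y^3 - a^3| ≤ |y^3| + |a^3| := abs_sub _ _
      _ = |y|^3 + |a|^3 := by rw [abs_pow, abs_pow]
      _ ≤ M^3 + M^3 := by gcongr
      _ = _ := by ring
  have hfac : q = (y-a)*(y^2+y*a+a^2) := by rw [hq]; ring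
  have hquad : 0 ≤ y^2+y*a+a^2 := by nlinarith [sq_nonneg (y+a), sq_nonneg y, sq_nonneg a]
  have hq2 : |q| ≤ 3*M^2*|y-a| := by
    rw [hfac, abs_mul, abs_of_nonneg hquad, mul_comm]
    gcongr
    nlinarith [sq_nonneg (y-a)]
  have hMq : M^3 ≤ |q| + |a|^3 := by
    rcases max_choice |y| |a| with h | h
    · rw [hM, h, ← abs_pow, ← abs_pow]
      have : y^3 = q + a^3 := by rw [hq]; ring
      rw [this]; exact abs_add_le _ _
    · rw [hM, h]; have := abs_nonneg q; linarith
  have hqq : q*|q| *(y-a) = |q|^2*|y-a| := by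
    have h1 : q*(y-a) = |q| *|y-a| := by
      rw [← abs_mul]; refine (abs_of_nonneg ?_).symm
      rw [hfac]; linarith [mul_nonneg (sq_nonneg (y-a)) hquad]
    linear_combination |q| * h1
  have habs3 : |a^3*b| ≤ 3*ε*|a|^3 := by
    rw [abs_mul, abs_pow]; have := pow_nonneg (abs_nonneg a) 3; nlinarith
  have hcore := core_ineq U A M |y-a| |q| |a| (a^3*b) ε γ K D hU0 hA0 hM0 (abs_nonneg _)
    (abs_nonneg _) (abs_nonneg _) haM hε hε1 hγ hK hUlow hUup hq1 hq2 hMq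
    ((le_abs_self _).trans habs3) ?_ ?_
  · intro N hN
    rcases hN with h | h | h
    · rw [h]; refine hcore.1.trans ?_
      have : |y|^7 ≤ M^7 := by gcongr
      nlinarith
    · rw [h]; exact hcore.2
    · rw [h]; refine hcore.1.trans ?_
      have : |a|^7 ≤ M^7 := by gcongr
      nlinarith
  · intro hc
    by_cases hs : 0 < (y^3 + K*v^3) * a
    · left
      have h := hb1 hs
      have ha0 : a ≠ 0 := by rintro rfl; simp at hs
      have h3 : 0 ≤ |a|^3 := by positivity
      have e : a^3*b = |a|^3*(b*SignType.sign a) := by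
        rcases lt_or_gt_of_ne ha0 with h | h
        · simp [h, abs_of_neg h]; ring
        · simp [h, abs_of_pos h]
      rw [e]; nlinarith
    · right
      push Not at hs
      have hv3 : |v^3| = A^3 := abs_pow _ _
      have hvl := neg_abs_le (v^3)
      have hvu := le_abs_self (v^3)
      rw [hv3] at hvl hvu
      have hql := neg_abs_le q
      have hqu := le_abs_self q
      have hA3 : 0 ≤ A^3 := by positivity
      rcases lt_trichotomy a 0 with h | h | h
      · rw [abs_of_neg h] at hc ⊢
        have hc' : |q| ≤ -a^3/2 := by convert hc using 1; ring
        have : 0 ≤ y^3 + K*v^3 := by by_contra h'; push Not at h'; nlinarith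
        have : K*v^3 ≤ K*A^3 := by gcongr
        nlinarith
      · rw [h]; simp; positivity
      · rw [abs_of_pos h] at hc ⊢
        have : y^3 + K*v^3 ≤ 0 := by by_contra h'; push Not at h'; nlinarith
        have : K*(-A^3) ≤ K*v^3 := by gcongr
        nlinarith
  · rw [hD, hqq, ← hA4]
    have h1 : -(q*b) ≤ 3*ε*|q| := by
      have : |q*b| ≤ 3*ε*|q| := by rw [abs_mul]; have := abs_nonneg q; nlinarith
      exact (neg_le_abs _).trans this
    have h2 : -(q*|q| *v) ≤ |q|^2*A := by
      refine (neg_le_abs _).trans ?_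
      rw [abs_mul, abs_mul, abs_abs, ← hA]; apply le_of_eq; ring
    have h3 : -(6*(v*A)*|q| *a^2*b) ≤ 18*ε*A^2*|a|^2*|q| := by
      refine (neg_le_abs _).trans ?_
      have : |6*(v*A)*|q| *a^2*b| = 6*(A*A)*|q| *|a|^2*|b| := by
        simp only [abs_mul, abs_abs, abs_pow, ← hA, abs_of_nonneg hA0]; norm_num
      rw [this]
      calc 6*(A*A)*|q| *|a|^2*|b| ≤ 6*(A*A)*|q| *|a|^2*(3*ε) := by gcongr
        _ = _ := by ring
    have h1' : 2*U*(-(q*b)) ≤ 2*U*(3*ε*|q|) := by gcongr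
    have h2' : γ*(-(q*|q| *v)) ≤ γ*(|q|^2*A) := by gcongr
    have h3' : γ*(-(6*(v*A)*|q| *a^2*b)) ≤ γ*(18*ε*A^2*|a|^2*|q|) := by gcongr
    linarith

lemma alg_pos (y v a ε γ : ℝ) (hε : 0 < ε) (hε1 : ε ≤ 1/12800000) (hγ : γ = 40000 * ε)
    (U q V D : ℝ) (hU : U = 3/4*y^4 - a*y^3 + 5/4*a^4 + v^4/2) (hq : q = y^3 - a^3)
    (hV : V = U^2 + γ*((v * |v|)*(q * |q|)))
    (hD : ∀ N, (N = |y| ∨ N = |v| ∨ N = |a|) → D ≤ -(ε/2)*N^7) :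
    0 ≤ V ∧ (V = 0 → y = 0 ∧ v = 0 ∧ a = 0) ∧ D ≤ -(ε/144) * V ^ (7/8 : ℝ) := by
  have hγ0 : 0 < γ := by rw [hγ]; positivity
  have hγ1 : γ ≤ 1/320 := by rw [hγ]; linarith
  obtain ⟨N, hN, hy, hv, ha⟩ : ∃ N, (N = |y| ∨ N = |v| ∨ N = |a|) ∧ |y| ≤ N ∧ |v| ≤ N ∧ |a| ≤ N := by
    rcases le_total |y| |v| with h1 | h1 <;> rcases le_total |v| |a| with h2 | h2 <;>
      rcases le_total |y| |a| with h3 | h3 <;>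
      first
      | exact ⟨|y|, Or.inl rfl, by assumption, by assumption, by assumption⟩
      | exact ⟨|y|, Or.inl rfl, le_rfl, by assumption, by assumption⟩
      | exact ⟨|v|, Or.inr (Or.inl rfl), by assumption, le_rfl, by assumption⟩
      | exact ⟨|a|, Or.inr (Or.inr rfl), by assumption, by assumption, le_rfl⟩
      | exact ⟨|a|, Or.inr (Or.inr rfl), by linarith, by linarith, by linarith⟩
      | exact ⟨|v|, Or.inr (Or.inl rfl), by linarith, by linarith, by linarith⟩
      | exact ⟨|y|, (Or.inl rfl), by linarith, by linarith, by linarith⟩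
  have hN0 : 0 ≤ N := (abs_nonneg _).trans hy
  have e4 : ∀ x : ℝ, |x|^4 = x^4 := fun x => by rw [← abs_pow]; exact abs_of_nonneg (by positivity)
  have hy4 : y^4 ≤ N^4 := by rw [← e4]; gcongr
  have hv4 : v^4 ≤ N^4 := by rw [← e4]; gcongr
  have ha4 : a^4 ≤ N^4 := by rw [← e4]; gcongr
  have hy0 : 0 ≤ y^4 := by positivity
  have hv0 : 0 ≤ v^4 := by positivity
  have ha0 : 0 ≤ a^4 := by positivity
  have hpoly : 0 ≤ 1/2*y^4 - a*y^3 + a^4 := by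
    have h1 : 0 ≤ (a^2 - 2/5*y^2)^2 := sq_nonneg _
    have h2 : 0 ≤ (y^2*4/5)*(a - 5/8*y)^2 := by positivity
    linarith
  have hlow : y^4 + a^4 + v^4 ≤ 4*U := by rw [hU]; linarith
  have hNU : N^4 ≤ 4*U := by
    rcases hN with h | h | h <;> rw [h, e4] <;> linarith
  have hup : U ≤ 6*N^4 := by
    rw [hU]
    have : -(a*y^3) ≤ N^4 := by
      calc -(a*y^3) ≤ |a*y^3| := neg_le_abs _
        _ = |a| * |y|^3 := by rw [abs_mul, abs_pow]
        _ ≤ N * N^3 := by gcongr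
        _ = N^4 := by ring
    linarith
  have hU0 : 0 ≤ U := by have := pow_nonneg hN0 4; linarith
  have hqN : |q| ≤ 2*N^3 := by
    rw [hq]
    calc |y^3 - a^3| ≤ |y^3| + |a^3| := abs_sub _ _
      _ = |y|^3 + |a|^3 := by rw [abs_pow, abs_pow]
      _ ≤ N^3 + N^3 := by gcongr
      _ = _ := by ring
  have hX : |(v * |v|)*(q * |q|)| ≤ 64*U^2 := by
    calc |(v * |v|)*(q * |q|)| = |v| * |v| * (|q| * |q|) := by simp only [abs_mul, abs_abs]
      _ ≤ N*N*((2*N^3)*(2*N^3)) := by gcongr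
      _ = 4*(N^4*N^4) := by ring
      _ ≤ 4*((4*U)*(4*U)) := by gcongr
      _ = _ := by ring
  have hX1 := neg_abs_le ((v * |v|)*(q * |q|))
  have hX2 := le_abs_self ((v * |v|)*(q * |q|))
  have hU2 : 0 ≤ U^2 := by positivity
  have hg1 : γ*(-(64*U^2)) ≤ γ*((v * |v|)*(q * |q|)) := by gcongr; linarith
  have hg2 : γ*((v * |v|)*(q * |q|)) ≤ γ*(64*U^2) := mul_le_mul_of_nonneg_left (by linarith) hγ0.le
  have hg3 : γ*U^2 ≤ 1/320*U^2 := by gcongr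
  have hVl : U^2/2 ≤ V := by rw [hV]; linarith
  have hVu : V ≤ 2*U^2 := by rw [hV]; linarith
  have hV0 : 0 ≤ V := by linarith
  refine ⟨hV0, ?_, ?_⟩
  · intro h
    have : U^2 = 0 := by linarith
    have hUz : U = 0 := by simpa using this
    refine ⟨?_, ?_, ?_⟩
    · have : y^4 = 0 := by linarith
      simpa using this
    · have : v^4 = 0 := by linarith
      simpa using this
    · have : a^4 = 0 := by linarith
      simpa using this
  · have h1 : V ≤ 72*N^8 := by
      calc V ≤ 2*U^2 := hVu
        _ ≤ 2*(6*N^4)^2 := by gcongr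
        _ = _ := by ring
    have h2 : V^(7/8:ℝ) ≤ 72*N^7 := by
      calc V^(7/8:ℝ) ≤ (72*N^8)^(7/8:ℝ) := by gcongr
        _ = 72^(7/8:ℝ) * (N^8)^(7/8:ℝ) := by rw [Real.mul_rpow (by norm_num) (by positivity)]
        _ ≤ 72^(1:ℝ) * N^7 := by
          have : (N^8)^(7/8:ℝ) = N^7 := by
            rw [← Real.rpow_natCast, ← Real.rpow_mul hN0, ← Real.rpow_natCast]; norm_num
          rw [this]
          gcongr <;> norm_num
        _ = _ := by norm_num
    have h3 : ε*(V^(7/8:ℝ)) ≤ ε*(72*N^7) := by gcongr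
    have := hD N hN
    linarith

/-! signed powers -/
lemma spow_third_cube (x : ℝ) : spow x (1/3) ^ 3 = x := by
  unfold spow
  have h : (|x|^(1/3:ℝ))^3 = |x| := by
    rw [← Real.rpow_natCast, ← Real.rpow_mul (abs_nonneg x)]; norm_num
  rw [mul_pow, h]
  rcases lt_trichotomy x 0 with h | h | h
  · rw [Real.sign_of_neg h, abs_of_neg h]; ring
  · simp [h]
  · rw [Real.sign_of_pos h, abs_of_pos h]; ring

lemma spow_third_four (x : ℝ) : |x| ^ (4/3:ℝ) = spow x (1/3) ^ 4 := by
  unfold spow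
  have h : (|x|^(1/3:ℝ))^4 = |x|^(4/3:ℝ) := by
    rw [← Real.rpow_natCast, ← Real.rpow_mul (abs_nonneg x)]; norm_num
  rw [mul_pow, h]
  rcases lt_trichotomy x 0 with h | h | h
  · rw [Real.sign_of_neg h]; ring
  · simp [h]
  · rw [Real.sign_of_pos h]; ring

lemma spow_half_sq (x : ℝ) : spow x (1/2) * |spow x (1/2)| = x := by
  unfold spow
  have h : (|x|^(1/2:ℝ))^2 = |x| := by
    rw [← Real.rpow_natCast, ← Real.rpow_mul (abs_nonneg x)]; norm_num
  have h0 : 0 ≤ |x|^(1/2:ℝ) := by positivity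
  rcases lt_trichotomy x 0 with h' | h' | h'
  · rw [Real.sign_of_neg h', abs_mul, abs_of_nonneg h0]
    rw [abs_of_neg h'] at h ⊢; simp; linarith
  · simp [h']
  · rw [Real.sign_of_pos h', abs_mul, abs_of_nonneg h0]
    rw [abs_of_pos h'] at h ⊢; simp; linarith

lemma spow_three_half (x : ℝ) : spow x (3/2) = spow x (1/2) ^ 3 := by
  unfold spow
  have h : (|x|^(1/2:ℝ))^3 = |x|^(3/2:ℝ) := by
    rw [← Real.rpow_natCast, ← Real.rpow_mul (abs_nonneg x)]; norm_num
  rw [mul_pow, h]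
  rcases lt_trichotomy x 0 with h | h | h
  · rw [Real.sign_of_neg h]; ring
  · simp [h]
  · rw [Real.sign_of_pos h]; ring

lemma hasDerivAt_abs_four_third (x : ℝ) :
    HasDerivAt (fun x : ℝ => |x|^(4/3:ℝ)) (4/3 * spow x (1/3)) x := by
  have h := hasDerivAt_abs_rpow x (p := 4/3) (by norm_num)
  convert h using 1
  unfold spow
  rcases eq_or_ne x 0 with h' | h'
  · simp [h']
  have hp : 0 < |x| := abs_pos.mpr h'
  have e : |x|^(1/3:ℝ) = |x|^(4/3-2:ℝ) * |x| := by
    rw [← Real.rpow_add_one hp.ne']; norm_num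
  rw [e]
  rcases lt_or_gt_of_ne h' with h | h
  · rw [Real.sign_of_neg h, abs_of_neg h]; ring
  · rw [Real.sign_of_pos h, abs_of_pos h]; ring

lemma hasDerivAt_mul_abs_self (x : ℝ) : HasDerivAt (fun x : ℝ => x * |x|) (2 * |x|) x := by
  rcases lt_trichotomy x 0 with h | h | h
  · have := (hasDerivAt_id x).mul (hasDerivAt_abs_neg h)
    exact this.congr_deriv (by rw [abs_of_neg h]; simp; ring)
  · subst h
    rw [hasDerivAt_iff_tendsto_slope_zero]
    simp only [zero_add, abs_zero, mul_zero, sub_zero, smul_eq_mul]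
    have : Filter.Tendsto (fun t : ℝ => |t|) (nhdsWithin 0 {0}ᶜ) (nhds 0) := by
      have := (continuous_abs (G := ℝ)).tendsto 0
      rw [abs_zero] at this
      exact this.mono_left nhdsWithin_le_nhds
    refine this.congr' ?_
    filter_upwards [self_mem_nhdsWithin] with t ht
    have : t ≠ 0 := ht
    field_simp
  · have := (hasDerivAt_id x).mul (hasDerivAt_abs_pos h)
    exact this.congr_deriv (by rw [abs_of_pos h]; simp; ring)

lemma continuous_spow (p : ℝ) (hp : 0 < p) : Continuous (fun x => spow x p) := by
  have : (fun x => spow x p) = fun x : ℝ => (max x 0)^p - (max (-x) 0)^p := by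
    funext x
    unfold spow
    rcases lt_trichotomy x 0 with h | h | h
    · rw [Real.sign_of_neg h, abs_of_neg h, max_eq_right h.le, max_eq_left (by linarith),
        Real.zero_rpow hp.ne']; ring
    · simp [h]
    · rw [Real.sign_of_pos h, abs_of_pos h, max_eq_left h.le, max_eq_right (by linarith),
        Real.zero_rpow hp.ne']; ring
  rw [this]
  have h1 : Continuous (fun x : ℝ => x^p) := Real.continuous_rpow_const hp.le
  exact (h1.comp (by fun_prop : Continuous fun x : ℝ => max x 0)).sub
    (h1.comp (by fun_prop : Continuous fun x : ℝ => max (-x) 0))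

/-! absolute continuity -/
lemma ac_comp_lip {f φ : ℝ → ℝ} {a b : ℝ} {K : NNReal} {S : Set ℝ}
    (hf : AbsolutelyContinuousOnInterval f a b) (hφ : LipschitzOnWith K φ S)
    (hS : ∀ x ∈ Set.uIcc a b, f x ∈ S) : AbsolutelyContinuousOnInterval (fun t => φ (f t)) a b := by
  rw [absolutelyContinuousOnInterval_iff] at hf ⊢
  intro ε hε
  obtain ⟨δ, hδ, h⟩ := hf (ε / (K+1)) (by positivity)
  refine ⟨δ, hδ, fun E hE hs => ?_⟩
  have h1 := h E hE hs
  calc _ ≤ ∑ i ∈ Finset.range E.1, K * dist (f (E.2 i).1) (f (E.2 i).2) := by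
        apply Finset.sum_le_sum
        intro i hi
        exact hφ.dist_le_mul _ (hS _ (hE.left i hi).left) _ (hS _ (hE.left i hi).right)
    _ = K * ∑ i ∈ Finset.range E.1, dist (f (E.2 i).1) (f (E.2 i).2) := (Finset.mul_sum _ _ _).symm
    _ ≤ K * (ε / (K + 1)) := by gcongr
    _ < (K + 1) * (ε / (K + 1)) := by gcongr; linarith
    _ = ε := by field

lemma ac_comp_c1 {f φ : ℝ → ℝ} {a b m M : ℝ}
    (hf : AbsolutelyContinuousOnInterval f a b) (hφ : ContDiffOn ℝ 1 φ (Set.Icc m M))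
    (hS : ∀ x ∈ Set.uIcc a b, f x ∈ Set.Icc m M) :
    AbsolutelyContinuousOnInterval (fun t => φ (f t)) a b := by
  obtain ⟨K, hK⟩ := hφ.exists_lipschitzOnWith (by decide) (convex_Icc _ _) isCompact_Icc
  exact ac_comp_lip hf hK hS

lemma ac_of_deriv {f f' : ℝ → ℝ} {a b : ℝ} (hab : a ≤ b)
    (hf : ∀ t ∈ Set.Icc a b, HasDerivAt f (f' t) t) (hf' : ContinuousOn f' (Set.Icc a b)) :
    AbsolutelyContinuousOnInterval f a b := by
  obtain ⟨C, hC⟩ := isCompact_Icc.exists_bound_of_continuousOn hf'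
  have : LipschitzOnWith C.toNNReal f (Set.uIcc a b) := by
    rw [Set.uIcc_of_le hab]
    refine (convex_Icc a b).lipschitzOnWith_of_nnnorm_hasDerivWithin_le
      (fun t ht => (hf t ht).hasDerivWithinAt) (fun t ht => ?_)
    rw [← NNReal.coe_le_coe, coe_nnnorm]
    exact (hC t ht).trans (Real.le_coe_toNNReal C)
  exact this.absolutelyContinuousOnInterval

lemma ac_decr {f : ℝ → ℝ} {a b c : ℝ} (hab : a ≤ b) (hf : AbsolutelyContinuousOnInterval f a b)
    (h : ∀ᵐ t, t ∈ Set.Icc a b → ∃ d, HasDerivAt f d t ∧ d ≤ -c) : f b ≤ f a - c * (b - a) := by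
  have h1 := hf.integral_deriv_eq_sub
  have h2 : ∫ x in a..b, deriv f x ≤ ∫ x in a..b, -c := by
    refine intervalIntegral.integral_mono_ae_restrict hab hf.intervalIntegrable_deriv
      intervalIntegrable_const ?_
    rw [Filter.EventuallyLE, ae_restrict_iff' measurableSet_Icc]
    filter_upwards [h] with t ht hmem
    obtain ⟨d, hd, hd'⟩ := ht hmem
    rw [hd.deriv]; exact hd'
  rw [intervalIntegral.integral_const, smul_eq_mul] at h2
  linarith

/-- Finite-time extinction for a nonnegative AC function. -/
lemma finite_time {V : ℝ → ℝ} {c : ℝ} (hc : 0 < c) (hV0 : ∀ t, 0 ≤ V t)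
    (hac : ∀ T, 0 ≤ T → AbsolutelyContinuousOnInterval V 0 T)
    (hd : ∀ᵐ t, 0 ≤ t → ∃ d, HasDerivAt V d t ∧ d ≤ -c * V t ^ (7/8 : ℝ)) :
    ∃ T ≥ 0, ∀ t ≥ T, V t = 0 := by
  have hex : ∃ T ≥ 0, V T = 0 := by
    by_contra hcon
    push Not at hcon
    have hpos : ∀ t, 0 ≤ t → 0 < V t := fun t ht => lt_of_le_of_ne (hV0 t) (hcon t ht).symm
    have key : ∀ T, 0 ≤ T → V T ^ (1/8:ℝ) ≤ V 0 ^ (1/8:ℝ) - (c/8) * (T - 0) := by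
      intro T hT
      have hcont : ContinuousOn V (Set.Icc 0 T) := by
        have := (hac T hT).continuousOn
        rwa [Set.uIcc_of_le hT] at this
      obtain ⟨tm, htm, hmin⟩ := isCompact_Icc.exists_isMinOn ⟨0, by simp [hT]⟩ hcont
      obtain ⟨tM, htM, hmax⟩ := isCompact_Icc.exists_isMaxOn ⟨0, by simp [hT]⟩ hcont
      refine ac_decr (f := fun t => V t ^ (1/8:ℝ)) hT ?_ ?_
      · refine ac_comp_c1 (φ := fun x => x ^ (1/8:ℝ)) (m := V tm) (M := V tM) (hac T hT) ?_ ?_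
        · intro x hx
          have : 0 < x := (hpos tm htm.1).trans_le hx.1
          exact (Real.contDiffAt_rpow_const_of_ne this.ne').contDiffWithinAt
        · intro x hx
          rw [Set.uIcc_of_le hT] at hx
          exact ⟨hmin hx, hmax hx⟩
      · filter_upwards [hd] with t ht hmem
        obtain ⟨d, hd1, hd2⟩ := ht hmem.1
        have hp := hpos t hmem.1
        refine ⟨_, hd1.rpow_const (p := 1/8) (Or.inl hp.ne'), ?_⟩
        have e : V t ^ (7/8:ℝ) * V t ^ (1/8 - 1:ℝ) = 1 := by
          rw [← Real.rpow_add hp]; norm_num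
        have h0 : 0 < V t ^ (1/8 - 1:ℝ) := Real.rpow_pos_of_pos hp _
        calc d * (1/8) * V t ^ (1/8 - 1:ℝ)
            ≤ (-c * V t ^ (7/8 : ℝ)) * (1/8) * V t ^ (1/8 - 1:ℝ) := by gcongr
          _ = -(c/8) * (V t ^ (7/8:ℝ) * V t ^ (1/8 - 1:ℝ)) := by ring
          _ = -(c/8) := by rw [e]; ring
    have h0 : 0 ≤ V 0 ^ (1/8:ℝ) := by have := hV0 0; positivity
    have h1 := key ((V 0 ^ (1/8:ℝ) + 1) / (c/8)) (by positivity)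
    have h2 : 0 ≤ V ((V 0 ^ (1/8:ℝ) + 1) / (c/8)) ^ (1/8:ℝ) := by
      have := hV0 ((V 0 ^ (1/8:ℝ) + 1) / (c/8)); positivity
    rw [sub_zero, mul_div_cancel₀ _ (by positivity)] at h1
    linarith
  obtain ⟨T, hT, hVT⟩ := hex
  refine ⟨T, hT, fun t ht => ?_⟩
  have := ac_decr (f := V) (a := T) (b := t) (c := 0) ht ((hac t (hT.trans ht)).mono ?_) ?_
  · have := hV0 t; linarith
  · rw [Set.uIcc_of_le ht, Set.uIcc_of_le (hT.trans ht)]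
    exact Set.Icc_subset_Icc_left hT
  · filter_upwards [hd] with s hs hmem
    obtain ⟨d, hd1, hd2⟩ := hs (hT.trans hmem.1)
    refine ⟨d, hd1, hd2.trans ?_⟩
    have : 0 ≤ V s ^ (7/8:ℝ) := by have := hV0 s; positivity
    nlinarith

/-- Theorem 1 (state feedback with discontinuous integral controller):
for every Lipschitz bound `L > 0` and every `k₄ ≥ 0` there are gains `k₁, k₂, k₃ > 0`
such that every Filippov solution of the closed loop
`ẋ₁ = x₂`, `ẋ₂ = −k₁⌈x₁⌋^{1/3} − k₂⌈x₂⌋^{1/2} + z + ρ(t)`,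
`ż = −k₃⌈x₁ + k₄⌈x₂⌋^{3/2}⌋⁰`
reaches `x₁ = x₂ = z + ρ = 0` in finite time. -/
theorem discontinuous_integral_controller_state_feedback :
    ∀ L > (0 : ℝ), ∀ k₄ ≥ (0 : ℝ),
      ∃ k₁ > (0 : ℝ), ∃ k₂ > (0 : ℝ), ∃ k₃ > (0 : ℝ),
        ∀ ρ : ℝ → ℝ, LipschitzWith L.toNNReal ρ →
        ∀ x₁ x₂ z : ℝ → ℝ,
          (∀ t ≥ (0 : ℝ), HasDerivAt x₁ (x₂ t) t) →
          (∀ t ≥ (0 : ℝ), HasDerivAt x₂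
            (-k₁ * spow (x₁ t) (1/3) - k₂ * spow (x₂ t) (1/2) + z t + ρ t) t) →
          LocallyLipschitz z →
          (∀ᵐ t ∂(volume.restrict (Set.Ici (0 : ℝ))),
            ∃ d : ℝ, HasDerivAt z d t ∧
              ((x₁ t + k₄ * spow (x₂ t) (3/2) ≠ 0 →
                 d = -k₃ * Real.sign (x₁ t + k₄ * spow (x₂ t) (3/2))) ∧
               (x₁ t + k₄ * spow (x₂ t) (3/2) = 0 → |d| ≤ k₃))) →
          ∃ T ≥ (0 : ℝ), ∀ t ≥ T, x₁ t = 0 ∧ x₂ t = 0 ∧ z t + ρ t = 0 := by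
  intro L hL k₄ hk₄
  set m : ℝ := 1 + 12800000 * L + 112 * (k₄ * L) with hm
  have hkL : 0 ≤ k₄ * L := by positivity
  have hm1 : 1 ≤ m := by rw [hm]; linarith
  have hm0 : 0 < m := by linarith
  refine ⟨m^4, by positivity, m^3, by positivity, 2*L, by positivity, ?_⟩
  intro ρ hρ x₁ x₂ z h1 h2 hz hae
  obtain ⟨ε, hεdef⟩ : ∃ ε, ε = L / m^6 := ⟨_, rfl⟩
  obtain ⟨γ, hγ⟩ : ∃ γ, γ = 40000 * ε := ⟨_, rfl⟩
  have hε : 0 < ε := by rw [hεdef]; positivity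
  have hε1 : ε ≤ 1/12800000 := by
    have : m ≤ m^6 := le_self_pow₀ hm1 (by norm_num)
    rw [hεdef, div_le_iff₀ (by positivity)]; linarith
  have hK0 : 0 ≤ k₄ * m^3 := by positivity
  have hK : ε * (k₄ * m^3) ≤ 1/112 := by
    have : m ≤ m^3 := le_self_pow₀ hm1 (by norm_num)
    have e : ε * (k₄ * m^3) = (k₄*L) / m^3 := by rw [hεdef]; field_simp
    rw [e, div_le_iff₀ (by positivity)]; linarith
  have hρac : ∀ T, AbsolutelyContinuousOnInterval ρ 0 T := fun T =>
    (hρ.lipschitzOnWith (s := Set.uIcc 0 T)).absolutelyContinuousOnInterval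
  have hzac : ∀ T, AbsolutelyContinuousOnInterval z 0 T := fun T => by
    obtain ⟨K, hK⟩ := (hz.locallyLipschitzOn (s := Set.uIcc 0 T)).exists_lipschitzOnWith_of_compact
      isCompact_uIcc
    exact hK.absolutelyContinuousOnInterval
  have hx1c : ∀ T, ContinuousOn x₁ (Set.Icc 0 T) := fun T t ht =>
    (h1 t ht.1).continuousAt.continuousWithinAt
  have hx2c : ∀ T, ContinuousOn x₂ (Set.Icc 0 T) := fun T t ht =>
    (h2 t ht.1).continuousAt.continuousWithinAt
  have hx1ac : ∀ T, 0 ≤ T → AbsolutelyContinuousOnInterval x₁ 0 T := fun T hT =>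
    ac_of_deriv hT (fun t ht => h1 t ht.1) (hx2c T)
  have hx2ac : ∀ T, 0 ≤ T → AbsolutelyContinuousOnInterval x₂ 0 T := fun T hT => by
    refine ac_of_deriv hT (fun t ht => h2 t ht.1) ?_
    have c1 : ContinuousOn (fun t => spow (x₁ t) (1/3)) (Set.Icc 0 T) :=
      (continuous_spow (1/3) (by norm_num)).comp_continuousOn (hx1c T)
    have c2 : ContinuousOn (fun t => spow (x₂ t) (1/2)) (Set.Icc 0 T) :=
      (continuous_spow (1/2) (by norm_num)).comp_continuousOn (hx2c T)
    exact (((continuousOn_const.mul c1).sub (continuousOn_const.mul c2)).add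
      hz.continuous.continuousOn).add hρ.continuous.continuousOn
  obtain ⟨a, ha⟩ : ∃ a : ℝ → ℝ, a = fun t => (1/m^4) * (z t + ρ t) := ⟨_, rfl⟩
  obtain ⟨w, hw⟩ : ∃ w : ℝ → ℝ, w = fun t => (1/m^2) * x₂ t := ⟨_, rfl⟩
  obtain ⟨U, hU⟩ : ∃ U : ℝ → ℝ, U = fun t => 3/4 * |x₁ t|^(4/3:ℝ) - a t * x₁ t
    + 5/4 * (a t * a t * a t * a t) + 1/2 * (w t * w t) := ⟨_, rfl⟩
  obtain ⟨q, hq⟩ : ∃ q : ℝ → ℝ, q = fun t => x₁ t - a t * a t * a t := ⟨_, rfl⟩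
  obtain ⟨V, hV⟩ : ∃ V : ℝ → ℝ, V = fun t => U t * U t + γ * (w t * (q t * |q t|)) := ⟨_, rfl⟩
  have haac : ∀ T, AbsolutelyContinuousOnInterval a 0 T := fun T => by
    rw [ha]; exact ((hzac T).add (hρac T)).const_mul _
  have hwac : ∀ T, 0 ≤ T → AbsolutelyContinuousOnInterval w 0 T := fun T hT => by
    rw [hw]; exact (hx2ac T hT).const_mul _
  have hUac : ∀ T, 0 ≤ T → AbsolutelyContinuousOnInterval U 0 T := fun T hT => by
    rw [hU]
    obtain ⟨C, hC⟩ := isCompact_Icc.exists_bound_of_continuousOn (hx1c T)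
    have hp : AbsolutelyContinuousOnInterval (fun t => |x₁ t|^(4/3:ℝ)) 0 T := by
      refine ac_comp_c1 (φ := fun x => |x|^(4/3:ℝ)) (m := -C) (M := C) (hx1ac T hT) ?_ ?_
      · have := contDiff_norm_rpow (E := ℝ) (p := 4/3) (by norm_num)
        exact this.contDiffOn
      · intro t ht
        rw [Set.uIcc_of_le hT] at ht
        exact abs_le.mp (hC t ht)
    have hA := haac T
    have hW := hwac T hT
    exact (((hp.const_mul _).sub (hA.mul (hx1ac T hT))).add
      ((((hA.mul hA).mul hA).mul hA).const_mul _)).add ((hW.mul hW).const_mul _)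
  have hqac : ∀ T, 0 ≤ T → AbsolutelyContinuousOnInterval q 0 T := fun T hT => by
    rw [hq]
    have hA := haac T
    exact (hx1ac T hT).sub ((hA.mul hA).mul hA)
  have hVac : ∀ T, 0 ≤ T → AbsolutelyContinuousOnInterval V 0 T := fun T hT => by
    rw [hV]
    have habs : AbsolutelyContinuousOnInterval (fun t => |q t|) 0 T :=
      ac_comp_lip (φ := fun x => |x|) (S := Set.univ) (K := 1) (hqac T hT)
        ((lipschitzWith_one_norm (E := ℝ)).lipschitzOnWith) (fun _ _ => Set.mem_univ _)
    exact ((hUac T hT).mul (hUac T hT)).add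
      (((hwac T hT).mul ((hqac T hT).mul habs)).const_mul _)
  -- algebraic coordinates
  obtain ⟨y, hy⟩ : ∃ y : ℝ → ℝ, y = fun t => spow (x₁ t) (1/3) := ⟨_, rfl⟩
  obtain ⟨v, hv⟩ : ∃ v : ℝ → ℝ, v = fun t => spow (x₂ t) (1/2) / m := ⟨_, rfl⟩
  have hy3 : ∀ t, y t ^ 3 = x₁ t := fun t => by rw [hy]; exact spow_third_cube _
  have hvw : ∀ t, v t * |v t| = w t := fun t => by
    rw [hv, hw]
    simp only
    rw [abs_div, abs_of_pos hm0]
    have := spow_half_sq (x₂ t)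
    field_simp
    linarith
  have hvs : ∀ t, spow (x₂ t) (1/2) = m * v t := fun t => by rw [hv]; field_simp
  have hww : ∀ t, w t * w t = v t ^ 4 := fun t => by
    rw [← hvw]
    have := abs_mul_abs_self (v t)
    linear_combination (v t)^2 * this
  have hUt : ∀ t, U t = 3/4*y t^4 - a t*y t^3 + 5/4*a t^4 + v t^4/2 := fun t => by
    rw [hy3, hU]
    simp only
    rw [hww, spow_third_four, hy]; ring
  have hqt : ∀ t, q t = y t^3 - a t^3 := fun t => by rw [hy3, hq]; ring
  have hVt : ∀ t, V t = U t^2 + γ*((v t * |v t|)*(q t * |q t|)) := fun t => by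
    rw [hvw, hV]; ring
  have hzero : ∀ t, V t = 0 → y t = 0 ∧ v t = 0 ∧ a t = 0 := fun t =>
    (alg_pos (y t) (v t) (a t) ε γ hε hε1 hγ (U t) (q t) (V t)
      (-(ε/2)*(|y t|^7 + |v t|^7 + |a t|^7)) (hUt t) (hqt t) (hVt t) (by
        intro N hN
        have e1 : 0 ≤ |y t|^7 := by positivity
        have e2 : 0 ≤ |v t|^7 := by positivity
        have e3 : 0 ≤ |a t|^7 := by positivity
        have : N^7 ≤ |y t|^7 + |v t|^7 + |a t|^7 := by
          rcases hN with h | h | h <;> rw [h] <;> linarith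
        nlinarith)).2.1
  have hV0 : ∀ t, 0 ≤ V t := fun t =>
    (alg_pos (y t) (v t) (a t) ε γ hε hε1 hγ (U t) (q t) (V t)
      (-(ε/2)*(|y t|^7 + |v t|^7 + |a t|^7)) (hUt t) (hqt t) (hVt t) (by
        intro N hN
        have e1 : 0 ≤ |y t|^7 := by positivity
        have e2 : 0 ≤ |v t|^7 := by positivity
        have e3 : 0 ≤ |a t|^7 := by positivity
        have : N^7 ≤ |y t|^7 + |v t|^7 + |a t|^7 := by
          rcases hN with h | h | h <;> rw [h] <;> linarith
        nlinarith)).1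
  have hderiv : ∀ᵐ t, 0 ≤ t → ∃ d, HasDerivAt V d t ∧ d ≤ -(m^2*(ε/144)) * V t ^ (7/8:ℝ) := by
    rw [ae_restrict_iff' measurableSet_Ici] at hae
    filter_upwards [hae, hρ.ae_differentiableAt] with t ht hρt ht0
    obtain ⟨d, hdz, hd1, hd2⟩ := ht ht0
    have hρd := hρt.hasDerivAt
    have hρb : |deriv ρ t| ≤ L := by
      have := norm_deriv_le_of_lipschitz hρ (x₀ := t)
      rwa [Real.coe_toNNReal _ hL.le] at this
    obtain ⟨r, hr⟩ : ∃ r, r = deriv ρ t := ⟨_, rfl⟩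
    rw [← hr] at hρd hρb
    obtain ⟨b, hb⟩ : ∃ b, b = (d + r) / m^6 := ⟨_, rfl⟩
    have ha' : HasDerivAt a (m^2*b) t := by
      rw [ha]
      refine ((hdz.add hρd).const_mul (1/m^4)).congr_deriv ?_
      rw [hb]; field_simp
    have hx1' : HasDerivAt x₁ (m^2 * w t) t := by
      refine (h1 t ht0).congr_deriv ?_
      rw [hw]; field_simp
    have hw' : HasDerivAt w (m^2*(-(y t - a t) - v t)) t := by
      rw [hw]
      refine ((h2 t ht0).const_mul (1/m^2)).congr_deriv ?_
      rw [hvs, ha, hy]; simp only; field_simp; ring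
    have hp' : HasDerivAt (fun t => |x₁ t|^(4/3:ℝ)) ((4/3 * y t) * (m^2 * w t)) t := by
      have := (hasDerivAt_abs_four_third (x₁ t)).comp t hx1'
      rw [hy]; exact this
    have hU' : HasDerivAt U (m^2*(-|v t|^3 - q t*b + 4*a t^3*b)) t := by
      rw [hU]
      refine ((((hp'.const_mul (3/4)).sub (ha'.mul hx1')).add
        ((((ha'.mul ha').mul ha').mul ha').const_mul (5/4))).add
          ((hw'.mul hw').const_mul (1/2))).congr_deriv ?_
      have e : |v t|^3 = w t * v t := by
        rw [← hvw]
        have := abs_mul_abs_self (v t)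
        linear_combination |v t| * this
      rw [e, hq]
      simp only [Pi.mul_apply]
      ring
    have hq' : HasDerivAt q (m^2*(w t - 3*a t^2*b)) t := by
      rw [hq]
      refine (hx1'.sub ((ha'.mul ha').mul ha')).congr_deriv ?_
      simp only [Pi.mul_apply]
      ring
    have hqq' : HasDerivAt (fun t => q t * |q t|) (2 * |q t| * (m^2*(w t - 3*a t^2*b))) t :=
      (hasDerivAt_mul_abs_self (q t)).comp t hq'
    obtain ⟨D, hD⟩ : ∃ D, D = 2*U t*(-|v t|^3 - q t*b + 4*a t^3*b) + γ*(2*v t^4 * |q t|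
        - q t * |q t| * (y t-a t) - q t * |q t| * v t - 6*(v t * |v t|) * |q t| * a t^2*b) := ⟨_, rfl⟩
    have hV' : HasDerivAt V (m^2 * D) t := by
      rw [hV]
      refine ((hU'.mul hU').add ((hw'.mul hqq').const_mul γ)).congr_deriv ?_
      rw [hD, hvw, ← hww]; ring
    refine ⟨_, hV', ?_⟩
    have hs : x₁ t + k₄ * spow (x₂ t) (3/2) = y t ^ 3 + (k₄ * m^3) * v t ^ 3 := by
      rw [hy3, spow_three_half, hvs]; ring
    rw [hs] at hd1 hd2
    have hdb : |d| ≤ 2*L := by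
      by_cases h0 : y t ^ 3 + (k₄ * m^3) * v t ^ 3 = 0
      · exact hd2 h0
      · rw [hd1 h0]
        rcases lt_or_gt_of_ne h0 with h | h
        · rw [Real.sign_of_neg h, abs_le]; constructor <;> linarith
        · rw [Real.sign_of_pos h, abs_le]; constructor <;> linarith
    have hbb : |b| ≤ 3*ε := by
      rw [hb, abs_div, abs_of_pos (show 0 < m^6 by positivity), hεdef, ← mul_div_assoc]
      gcongr
      exact (abs_add_le _ _).trans (by linarith)
    have hb1 : 0 < (y t^3 + (k₄ * m^3)*v t^3) * a t → b * SignType.sign (a t) ≤ -ε := by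
      intro hpos
      have hne : y t^3 + (k₄ * m^3)*v t^3 ≠ 0 := fun h => by rw [h, zero_mul] at hpos; exact lt_irrefl _ hpos
      have hdd := hd1 hne
      have hρ2 := abs_le.mp hρb
      have key : (d + r) * SignType.sign (a t) ≤ -L := by
        rcases pos_and_pos_or_neg_and_neg_of_mul_pos hpos with ⟨h, h'⟩ | ⟨h, h'⟩
        · rw [Real.sign_of_pos h] at hdd
          simp only [sign_pos h', SignType.coe_one]; linarith [hρ2.2]
        · rw [Real.sign_of_neg h] at hdd
          simp only [sign_neg h', SignType.coe_neg_one]; linarith [hρ2.1]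
      calc b * SignType.sign (a t) = ((d + r) * SignType.sign (a t)) / m^6 := by rw [hb]; ring
        _ ≤ (-L) / m^6 := by gcongr
        _ = -ε := by rw [hεdef]; ring
    have hDN := alg_ineq (y t) (v t) (a t) b ε γ (k₄ * m^3) hε hε1 hγ hK hK0 hbb hb1
      (U t) (q t) D (hUt t) (hqt t) hD
    have := (alg_pos (y t) (v t) (a t) ε γ hε hε1 hγ (U t) (q t) (V t) D (hUt t) (hqt t)
      (hVt t) hDN).2.2
    calc m^2 * D ≤ m^2 * (-(ε/144) * V t ^ (7/8:ℝ)) := by gcongr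
      _ = _ := by ring
  obtain ⟨T, hT, hVT⟩ := finite_time (by positivity) hV0 hVac hderiv
  refine ⟨T, hT, fun t ht => ?_⟩
  obtain ⟨e1, e2, e3⟩ := hzero t (hVT t ht)
  refine ⟨?_, ?_, ?_⟩
  · rw [← hy3, e1]; norm_num
  · have := hvw t
    rw [e2, hw] at this
    simp only [zero_mul] at this
    have hm2 : (1/m^2) ≠ 0 := by positivity
    exact (mul_eq_zero.mp this.symm).resolve_left hm2
  · rw [ha] at e3
    have hm2 : (1/m^4) ≠ 0 := by positivity
    exact (mul_eq_zero.mp e3).resolve_left hm2
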